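/- arXiv:1810.04599 — 2 statements merged into one kernel-verified Lean document; each statement's English description precedes it below -/
import Mathlib

section
/- Let G = (V, E, ℓ) be a vertex-labeled directed graph and let u, v ∈ V be distinct vertices. If u and v are in-trace equivalent (u ≡in v), then merging u into v introduces no new paths, i.e., every trace of a path of merge(G, u, v) is the trace of some path of G. -/
/-- A path of `G = (V, E)`: a nonempty finite sequence of vertices with
consecutive vertices related by `E`. -/
def IsPath {V : Type*} (E : V → V → Prop) (p : List V) : Prop :=
  p ≠ [] ∧ p.Chain' E

/-- `u` is in-trace dominated by `v`: for every path ending at `u` there is a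
path ending at `v` with the same trace. -/
def InTraceDom {V L : Type*} (E : V → V → Prop) (ℓ : V → L) (u v : V) : Prop :=
  ∀ p : List V, IsPath E p → p.getLast? = some u →
    ∃ q : List V, IsPath E q ∧ q.getLast? = some v ∧ q.map ℓ = p.map ℓ

/-- The edge relation of `merge(G, u, v)`. -/
def MergeEdge {V : Type*} (E : V → V → Prop) (u v : V) (a b : V) : Prop :=
  E a b ∨ (a = v ∧ E u b) ∨ (b = v ∧ E a u)

/-- A path of `merge(G, u, v)`. -/
def IsMergePath {V : Type*} (E : V → V → Prop) (u v : V) (p : List V) : Prop :=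
  p ≠ [] ∧ (∀ x ∈ p, x ≠ u) ∧ p.Chain' (MergeEdge E u v)

/-- Merging `u` into `v` introduces no new paths. -/
def NoNewPaths {V L : Type*} (E : V → V → Prop) (ℓ : V → L) (u v : V) : Prop :=
  ∀ p : List V, IsMergePath E u v p →
    ∃ q : List V, IsPath E q ∧ q.map ℓ = p.map ℓ

theorem IsPath.concat {V : Type*} {E : V → V → Prop} {p : List V} {a b : V}
    (hp : IsPath E p) (ha : p.getLast? = some a) (hab : E a b) : IsPath E (p ++ [b]) := by
  refine ⟨by simp, List.isChain_append.2 ⟨hp.2, List.isChain_singleton b, ?_⟩⟩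
  intro x hx y hy
  simp_all

theorem InTraceDom.label_eq {V L : Type*} {E : V → V → Prop} {ℓ : V → L} {u v : V}
    (h : InTraceDom E ℓ u v) : ℓ u = ℓ v := by
  obtain ⟨q, -, hv, hq⟩ := h [u] ⟨by simp, List.isChain_singleton u⟩ rfl
  have hlast := congrArg List.getLast? hq
  simpa [List.getLast?_map, hv] using hlast.symm

/-- Every path of the merged graph can be replaced by a path of the original graph with the same
trace and the same last vertex. -/
theorem exists_isPath_of_isChain_mergeEdge {V L : Type*} {E : V → V → Prop} {ℓ : V → L} {u v : V}
    (h₁ : InTraceDom E ℓ u v) (h₂ : InTraceDom E ℓ v u) (p : List V) (hne : p ≠ [])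
    (hp : p.IsChain (MergeEdge E u v)) :
    ∃ q : List V, IsPath E q ∧ q.getLast? = p.getLast? ∧ q.map ℓ = p.map ℓ := by
  induction p using List.reverseRecOn with
  | nil => exact absurd rfl hne
  | append_singleton p x ih =>
    rcases List.eq_nil_or_concat p with rfl | ⟨r, a, hr⟩
    · exact ⟨[x], ⟨by simp, List.isChain_singleton x⟩, by simp, by simp⟩
    · obtain ⟨hchain, -, hedge⟩ := List.isChain_append.1 hp
      have hlast : p.getLast? = some a := by simp [hr]
      obtain ⟨q, hq, hqa, hqp⟩ := ih (by simp [hr]) hchain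
      rw [hlast] at hqa
      rcases hedge a (by simp [hlast]) x (by simp) with h | ⟨rfl, h⟩ | ⟨rfl, h⟩
      · exact ⟨q ++ [x], hq.concat hqa h, by simp, by simp [hqp]⟩
      · obtain ⟨q', hq', hu, hq'q⟩ := h₂ q hq hqa
        exact ⟨q' ++ [x], hq'.concat hu h, by simp, by simp [hq'q, hqp]⟩
      · obtain ⟨q', hq', hv, hq'q⟩ := h₁ (q ++ [u]) (hq.concat hqa h) (by simp)
        exact ⟨q', hq', by simp [hv], by simp [hq'q, hqp, h₁.label_eq]⟩

/-- If `u ≡in v` (in-trace equivalent), merging `u` into `v` introduces no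
new paths. -/
theorem inTraceEquiv_merge_no_new_paths {V L : Type*}
    (E : V → V → Prop) (ℓ : V → L) (u v : V) (hne : u ≠ v)
    (h₁ : InTraceDom E ℓ u v) (h₂ : InTraceDom E ℓ v u) :
    NoNewPaths E ℓ u v := by
  rintro p ⟨hp, -, hchain⟩
  obtain ⟨q, hq, -, hqp⟩ := exists_isPath_of_isChain_mergeEdge h₁ h₂ p hp hchain
  exact ⟨q, hq, hqp⟩
end

section
/- Let a PROV graph with entities 𝔈, activities 𝔄, used edges U ⊆ 𝔄 × 𝔈 and wasGeneratedBy edges G ⊆ 𝔈 × 𝔄 be given, with destination entity d ∈ 𝔈. If e₁, e₂ ∈ 𝔈 and there is a path from e₁ to e₂ in the extended graph whose path segment label lies in L_sim(d), then there is a path from e₂ to e₁ in the extended graph whose path segment label lies in L_sim(d); in fact, with the same path segment label. -/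
/-- The alphabet `Σ = {u, u⁻, g, g⁻, E, A, d}` of seven distinct symbols. -/
inductive ProvSym : Type
  | u | ub | g | gb | E | A | d
  deriving DecidableEq

/-- The language `L_sim(d)` generated by the context-free grammar with start
symbol `S` and productions `S → g⁻ E S E g`, `S → u⁻ A S A u`,
`S → g⁻ d g`. -/
inductive Lsim : List ProvSym → Prop
  | base : Lsim [ProvSym.gb, ProvSym.d, ProvSym.g]
  | gstep (w : List ProvSym) : Lsim w →
      Lsim ([ProvSym.gb, ProvSym.E] ++ w ++ [ProvSym.E, ProvSym.g])
  | ustep (w : List ProvSym) : Lsim w →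
      Lsim ([ProvSym.ub, ProvSym.A] ++ w ++ [ProvSym.A, ProvSym.u])

/-- The labeled edges of the extended graph of a PROV graph with entities
`Ent`, activities `Act`, used edges `U` and wasGeneratedBy edges `G`:
each used edge `(a, e) ∈ U` gives `a →ᵘ e` and `e →ᵘ⁻ a`; each
wasGeneratedBy edge `(e, a) ∈ G` gives `e →ᵍ a` and `a →ᵍ⁻ e`. -/
inductive ProvEdge {Ent Act : Type*} (U : Act → Ent → Prop)
    (G : Ent → Act → Prop) : Ent ⊕ Act → ProvSym → Ent ⊕ Act → Prop
  | used {a : Act} {e : Ent} : U a e → ProvEdge U G (Sum.inr a) ProvSym.u (Sum.inl e)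
  | usedInv {a : Act} {e : Ent} : U a e → ProvEdge U G (Sum.inl e) ProvSym.ub (Sum.inr a)
  | gen {e : Ent} {a : Act} : G e a → ProvEdge U G (Sum.inl e) ProvSym.g (Sum.inr a)
  | genInv {e : Ent} {a : Act} : G e a → ProvEdge U G (Sum.inr a) ProvSym.gb (Sum.inl e)

/-- Vertex labels of the extended graph: `d` for the destination entity `d`,
`E` for any other entity, `A` for any activity. -/
def provLabel {Ent Act : Type*} [DecidableEq Ent] (d : Ent) :
    Ent ⊕ Act → ProvSym
  | Sum.inl e => if e = d then ProvSym.d else ProvSym.E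
  | Sum.inr _ => ProvSym.A

/-- `PathSeg Edg lab x w y`: there is a path from `x` to `y` in the
edge-labeled graph `Edg` whose path segment label (the concatenation of the
labels of all edges and of all interior vertices) is `w`. -/
inductive PathSeg {V S : Type*} (Edg : V → S → V → Prop) (lab : V → S) :
    V → List S → V → Prop
  | single {x y : V} {s : S} : Edg x s y → PathSeg Edg lab x [s] y
  | cons {x y z : V} {s : S} {w : List S} :
      Edg x s y → PathSeg Edg lab y w z → PathSeg Edg lab x (s :: lab y :: w) z

theorem PathSeg.snoc {V S : Type*} {Edg : V → S → V → Prop} {lab : V → S} {x y z : V}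
    {w : List S} {s : S} (h : PathSeg Edg lab x w y) (e : Edg y s z) :
    PathSeg Edg lab x (w ++ [lab y, s]) z := by
  induction h with
  | single e' => exact .cons e' (.single e)
  | cons e' _ ih => exact .cons e' (ih e)

theorem PathSeg.ne_nil {V S : Type*} {Edg : V → S → V → Prop} {lab : V → S} {x y : V}
    {w : List S} (h : PathSeg Edg lab x w y) : w ≠ [] := by
  cases h <;> simp

theorem PathSeg.exists_of_snoc {V S : Type*} {Edg : V → S → V → Prop} {lab : V → S} {x z : V}
    {w : List S} {l s : S} (h : PathSeg Edg lab x (w ++ [l, s]) z) :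
    ∃ y, lab y = l ∧ PathSeg Edg lab x w y ∧ Edg y s z := by
  generalize hv : w ++ [l, s] = v at h
  induction h generalizing w with
  | single e => simpa using congrArg List.length hv
  | @cons x y z t v e p ih =>
    match w, hv with
    | [], hv => exact absurd (by simpa using (List.cons.inj (List.cons.inj hv).2).2.symm) p.ne_nil
    | [a], hv =>
      simp only [List.cons_append, List.nil_append, List.cons.injEq] at hv
      obtain ⟨rfl, rfl, rfl⟩ := hv
      cases p with
      | single e' => exact ⟨y, rfl, .single e, e'⟩
    | a :: b :: w', hv =>
      simp only [List.cons_append, List.cons.injEq] at hv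
      obtain ⟨rfl, rfl, hv⟩ := hv
      obtain ⟨y', hl, p', e'⟩ := ih hv
      exact ⟨y', hl, .cons e p', e'⟩

/-- If `s`-edges and `t`-edges are mutually inverse, reversibility of the `w`-labeled paths
extends to the paths labeled `s l w l t`. -/
theorem PathSeg.symm_wrap {V S : Type*} {Edg : V → S → V → Prop} {lab : V → S} {s t l : S}
    {w : List S} (hst : ∀ x y, Edg x s y ↔ Edg y t x)
    (hw : ∀ x y, PathSeg Edg lab x w y → PathSeg Edg lab y w x) {x y : V}
    (h : PathSeg Edg lab x ([s, l] ++ w ++ [l, t]) y) :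
    PathSeg Edg lab y ([s, l] ++ w ++ [l, t]) x := by
  obtain ⟨b, hb, p, eb⟩ := h.exists_of_snoc
  generalize hv : [s, l] ++ w = v at p
  cases p with
  | single e => simp at hv
  | @cons _ a _ _ _ e p =>
    simp only [List.cons_append, List.nil_append, List.cons.injEq] at hv
    obtain ⟨rfl, ha, rfl⟩ := hv
    have q := PathSeg.cons ((hst _ _).2 eb) ((hw _ _ p).snoc ((hst _ _).1 e))
    rw [hb] at q
    simpa [← ha] using q

theorem provEdge_gb_iff {Ent Act : Type*} {U : Act → Ent → Prop} {G : Ent → Act → Prop}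
    (x y : Ent ⊕ Act) : ProvEdge U G x ProvSym.gb y ↔ ProvEdge U G y ProvSym.g x :=
  ⟨fun | .genInv h => .gen h, fun | .gen h => .genInv h⟩

theorem provEdge_ub_iff {Ent Act : Type*} {U : Act → Ent → Prop} {G : Ent → Act → Prop}
    (x y : Ent ⊕ Act) : ProvEdge U G x ProvSym.ub y ↔ ProvEdge U G y ProvSym.u x :=
  ⟨fun | .usedInv h => .used h, fun | .used h => .usedInv h⟩

theorem Lsim.pathSeg_symm {Ent Act : Type*} {U : Act → Ent → Prop} {G : Ent → Act → Prop}
    {lab : Ent ⊕ Act → ProvSym} {w : List ProvSym} (hw : Lsim w) (x y : Ent ⊕ Act)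
    (h : PathSeg (ProvEdge U G) lab x w y) : PathSeg (ProvEdge U G) lab y w x := by
  induction hw generalizing x y with
  | base =>
    obtain ⟨v, hv, p, e⟩ := PathSeg.exists_of_snoc (w := [ProvSym.gb]) h
    cases p with
    | single e' =>
      rw [← hv]
      exact .cons ((provEdge_gb_iff _ _).2 e) (.single ((provEdge_gb_iff _ _).1 e'))
  | gstep w _ ih => exact PathSeg.symm_wrap provEdge_gb_iff ih h
  | ustep w _ ih => exact PathSeg.symm_wrap provEdge_ub_iff ih h

/-- If there is a path from `e₁` to `e₂` in the extended graph of a PROV graph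
whose path segment label lies in `L_sim(d)`, then there is a path from `e₂` to
`e₁` with path segment label in `L_sim(d)` — in fact with the same label. -/
theorem lsim_path_symm {Ent Act : Type*} [Fintype Ent] [Fintype Act]
    [DecidableEq Ent]
    (U : Act → Ent → Prop) (G : Ent → Act → Prop) (d : Ent)
    (e₁ e₂ : Ent) (w : List ProvSym)
    (hpath : PathSeg (ProvEdge U G) (provLabel d) (Sum.inl e₁) w (Sum.inl e₂))
    (hw : Lsim w) :
    PathSeg (ProvEdge U G) (provLabel d) (Sum.inl e₂) w (Sum.inl e₁) := by
  exact hw.pathSeg_symm _ _ hpath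
end
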